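/- Let 0 < T < S < 1. Then there exists r₀ > 0 such that Q_{S,T}(r) = π/(√(1−T)·√(1−S)·√(1−√T)·√(1−√S)) for every r > r₀. -/

import Mathlib

open MeasureTheory

/-- `R = 2r(1−√T)(1−√S)`. -/
noncomputable def Rc (S T r : ℝ) : ℝ := 2 * r * (1 - Real.sqrt T) * (1 - Real.sqrt S)

/-- `E(r) = (√T+√S−2√S√T)² + 2R√S√T`. -/
noncomputable def Ec (S T r : ℝ) : ℝ :=
  (Real.sqrt T + Real.sqrt S - 2 * Real.sqrt S * Real.sqrt T) ^ 2 +
    2 * Rc S T r * Real.sqrt S * Real.sqrt T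

/-- `F(r) = 2(√T+√S−2)(√T+√S−2√S√T) + 2R(1+√S√T−2√T−2√S) + R²`. -/
noncomputable def Fc (S T r : ℝ) : ℝ :=
  2 * (Real.sqrt T + Real.sqrt S - 2) *
      (Real.sqrt T + Real.sqrt S - 2 * Real.sqrt S * Real.sqrt T) +
    2 * Rc S T r * (1 + Real.sqrt S * Real.sqrt T - 2 * Real.sqrt T - 2 * Real.sqrt S) +
    Rc S T r ^ 2

/-- `G(r) = (√T+√S−2)² + 2R`. -/
noncomputable def Gc (S T r : ℝ) : ℝ :=
  (Real.sqrt T + Real.sqrt S - 2) ^ 2 + 2 * Rc S T r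

/-- `I₂(r,z) = (√T+√S−2√S√T + R√z + z(√T+√S−2))/(E(r)+F(r)z+G(r)z²)`. -/
noncomputable def I2c (S T r z : ℝ) : ℝ :=
  (Real.sqrt T + Real.sqrt S - 2 * Real.sqrt S * Real.sqrt T + Rc S T r * Real.sqrt z +
      z * (Real.sqrt T + Real.sqrt S - 2)) /
    (Ec S T r + Fc S T r * z + Gc S T r * z ^ 2)

/-- `Q_{S,T}(r) = (1+r)·∫_T^S I₂(r,z)/((1+√z)√(√z−√T)√(√S−√z)) dz`. -/
noncomputable def Qc (S T r : ℝ) : ℝ :=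
  (1 + r) * ∫ z in T..S, I2c S T r z /
    ((1 + Real.sqrt z) * Real.sqrt (Real.sqrt z - Real.sqrt T) *
      Real.sqrt (Real.sqrt S - Real.sqrt z))


lemma aux_w (t s x : ℝ) (h1 : t < x) (h2 : x < s) :
    HasDerivAt (fun x => Real.sqrt ((x - t) * (s - x)))
      ((s + t - 2 * x) / (2 * Real.sqrt ((x - t) * (s - x)))) x := by
  have h : HasDerivAt (fun x => (x - t) * (s - x)) (s + t - 2 * x) x := by
    have := ((hasDerivAt_id x).sub_const t).mul ((hasDerivAt_id x).const_sub s)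
    refine this.congr_deriv ?_
    simp only [id]
    ring
  have hp : (x - t) * (s - x) ≠ 0 := (mul_pos (by linarith) (by linarith)).ne'
  exact h.sqrt hp

/-- The arcsine part. -/
noncomputable def auxJ (t s x : ℝ) : ℝ :=
  Real.arcsin (((1 + t) + (1 + s) - 2 * ((1 + t) * (1 + s)) / (1 + x)) / (s - t)) /
    Real.sqrt ((1 + t) * (1 + s))

lemma auxJ_deriv (t s x : ℝ) (h0 : 0 < t) (h1 : t < x) (h2 : x < s) :
    HasDerivAt (auxJ t s) (1 / ((1 + x) * Real.sqrt ((x - t) * (s - x)))) x := by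
  have hst : 0 < s - t := by linarith
  have hx : 0 < 1 + x := by linarith
  have hm : HasDerivAt
      (fun x => ((1 + t) + (1 + s) - 2 * ((1 + t) * (1 + s)) / (1 + x)) / (s - t))
      ((2 * ((1 + t) * (1 + s)) / (1 + x) ^ 2) / (s - t)) x := by
    have := ((((hasDerivAt_id x).const_add 1).fun_inv hx.ne').const_mul
      (2 * ((1 + t) * (1 + s)))).const_sub ((1 + t) + (1 + s))
    have := this.div_const (s - t)
    refine (this.congr_deriv ?_)
    simp only [id]
    ring
  set m := ((1 + t) + (1 + s) - 2 * ((1 + t) * (1 + s)) / (1 + x)) / (s - t) with hmdef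
  have hK : 0 < (1 + t) * (1 + s) := by apply mul_pos <;> linarith
  have hw : 0 < (x - t) * (s - x) := mul_pos (by linarith) (by linarith)
  have hm1 : 1 - m = 2 * (1 + t) * (s - x) / ((1 + x) * (s - t)) := by
    rw [hmdef]; field_simp; ring
  have hm2 : 1 + m = 2 * (1 + s) * (x - t) / ((1 + x) * (s - t)) := by
    rw [hmdef]; field_simp; ring
  have p1 : 0 < 1 - m := by
    rw [hm1]; apply div_pos (mul_pos (by linarith) (by linarith)) (mul_pos hx hst)
  have p2 : 0 < 1 + m := by
    rw [hm2]; apply div_pos (mul_pos (by linarith) (by linarith)) (mul_pos hx hst)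
  have hs : Real.sqrt (1 - m ^ 2) = 2 * Real.sqrt ((1 + t) * (1 + s)) *
      Real.sqrt ((x - t) * (s - x)) / ((1 + x) * (s - t)) := by
    rw [Real.sqrt_eq_iff_mul_self_eq (by nlinarith) (by positivity)]
    have e1 := Real.mul_self_sqrt hK.le
    have e2 := Real.mul_self_sqrt hw.le
    have : 1 - m ^ 2 = (1 - m) * (1 + m) := by ring
    rw [this, hm1, hm2, div_mul_div_comm, div_mul_div_comm]
    congr 1
    linear_combination (-4 * Real.sqrt ((x - t) * (s - x)) ^ 2) * e1 -
      4 * ((1 + t) * (1 + s)) * e2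
  have := (Real.hasDerivAt_arcsin (x := m) (by linarith) (by linarith)).comp x hm
  have := this.div_const (Real.sqrt ((1 + t) * (1 + s)))
  refine this.congr_deriv ?_
  rw [hs]
  have q1 := Real.sqrt_pos.2 hK
  have q2 := Real.sqrt_pos.2 hw
  have e1 := Real.sq_sqrt hK.le
  field_simp
  rw [e1]

/-- The logarithmic part. -/
noncomputable def auxL (t s a b x : ℝ) : ℝ :=
  Real.log (a * x + b + Real.sqrt ((x - t) * (s - x))) -
    Real.log (a * x + b - Real.sqrt ((x - t) * (s - x)))

lemma auxL_pos (t s a b p x : ℝ) (ha : 0 < a) (hb : 0 < b) (hp : 0 < p) (h0 : 0 < t)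
    (hab : 2 * a * b = s + t) (hab2 : b ^ 2 + s * t = (a ^ 2 + 1) * p)
    (h1 : t ≤ x) (h2 : x ≤ s) :
    0 < a * x + b + Real.sqrt ((x - t) * (s - x)) ∧
    0 < a * x + b - Real.sqrt ((x - t) * (s - x)) := by
  have hx : 0 < x := by linarith
  have hl : 0 < a * x + b := by positivity
  have hw : 0 ≤ (x - t) * (s - x) := mul_nonneg (by linarith) (by linarith)
  refine ⟨by positivity, ?_⟩
  rw [sub_pos, Real.sqrt_lt' hl]
  have : (a * x + b) ^ 2 - (x - t) * (s - x) = (a ^ 2 + 1) * (x ^ 2 + p) := by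
    linear_combination x * hab + hab2
  have : 0 < (a ^ 2 + 1) * (x ^ 2 + p) := by positivity
  linarith

lemma auxL_deriv (t s a b p x : ℝ) (ha : 0 < a) (hb : 0 < b) (hp : 0 < p) (h0 : 0 < t)
    (hab : 2 * a * b = s + t) (hab2 : b ^ 2 + s * t = (a ^ 2 + 1) * p)
    (h1 : t < x) (h2 : x < s) :
    HasDerivAt (auxL t s a b)
      (2 * (a * p - b * x) / (Real.sqrt ((x - t) * (s - x)) * (x ^ 2 + p))) x := by
  obtain ⟨q1, q2⟩ := auxL_pos t s a b p x ha hb hp h0 hab hab2 h1.le h2.le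
  have hw : 0 < (x - t) * (s - x) := mul_pos (by linarith) (by linarith)
  have dw := aux_w t s x h1 h2
  have dl : HasDerivAt (fun x => a * x + b) a x := by
    simpa using ((hasDerivAt_id x).const_mul a).add_const b
  have := ((dl.add dw).log q1.ne').sub ((dl.sub dw).log q2.ne')
  refine this.congr_deriv ?_
  have q3 := Real.sqrt_pos.2 hw
  have e := Real.sq_sqrt hw.le
  simp only [Pi.add_apply, Pi.sub_apply]
  set w := Real.sqrt ((x - t) * (s - x)) with hwd
  have hD : (a * x + b + w) * (a * x + b - w) = (a ^ 2 + 1) * (x ^ 2 + p) := by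
    linear_combination x * hab + hab2 - e
  have hxp : 0 < x ^ 2 + p := by positivity
  have ha2 : 0 < a ^ 2 + 1 := by positivity
  rw [div_sub_div _ _ q1.ne' q2.ne', hD]
  rw [div_eq_div_iff (by positivity) (by positivity)]
  have : ((a + (s + t - 2 * x) / (2 * w)) * (a * x + b - w) -
      (a * x + b + w) * (a - (s + t - 2 * x) / (2 * w))) * w
      = 2 * (a * p - b * x) * (a ^ 2 + 1) := by
    have : (a + (s + t - 2 * x) / (2 * w)) * (a * x + b - w) -
      (a * x + b + w) * (a - (s + t - 2 * x) / (2 * w)) =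
      ((s + t - 2 * x) * (a * x + b) - 2 * a * w ^ 2) / w := by
      field_simp; ring
    rw [this, div_mul_cancel₀ _ q3.ne', e]
    linear_combination (a * x - b) * hab + 2 * a * hab2
  linear_combination (x ^ 2 + p) * this

lemma aux_ab (t s R k p : ℝ) (hk : k ^ 2 = 2 * R) (hk0 : 0 < k) (hp : 0 < p)
    (ht : 0 < t) (hs : 0 < s) (hA : 0 < t + s - 2 * s * t) (hB : 0 < 2 - t - s) (hR : 0 < R)
    (hD : ((t + s - 2 * s * t) ^ 2 + 2 * R * s * t) -
      (2 * (t + s - 2) * (t + s - 2 * s * t) + 2 * R * (1 + s * t - 2 * t - 2 * s) + R ^ 2) * p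
      + ((t + s - 2) ^ 2 + 2 * R) * p ^ 2 = 0) :
    ∃ a b : ℝ, 0 < a ∧ 0 < b ∧ 2 * a * b = s + t ∧ b ^ 2 + s * t = (a ^ 2 + 1) * p ∧
      k * a = (R - (t + s - 2 * s * t) - (2 - t - s) * p) / (1 + p) ∧
      k * b = ((t + s - 2 * s * t) + (2 - t - s) * p + R * p) / (1 + p) := by
  have h1p : 0 < 1 + p := by linarith
  set u := R - (t + s - 2 * s * t) - (2 - t - s) * p with hu
  set v := (t + s - 2 * s * t) + (2 - t - s) * p + R * p with hv
  have hv0 : 0 < v := by positivity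
  have i1 : 2 * u * v = (s + t) * (k * (1 + p)) ^ 2 := by
    rw [mul_pow, hk, hu, hv]
    linear_combination (-2) * hD
  have i2 : v ^ 2 + s * t * (k * (1 + p)) ^ 2 = (u ^ 2 + (k * (1 + p)) ^ 2) * p := by
    rw [mul_pow, hk, hu, hv]
    linear_combination (1 - p) * hD
  have hb : 0 < v / (k * (1 + p)) := by positivity
  have hab : 2 * (u / (k * (1 + p))) * (v / (k * (1 + p))) = s + t := by
    field_simp
    linear_combination i1
  refine ⟨u / (k * (1 + p)), v / (k * (1 + p)), ?_, hb, hab, ?_, ?_, ?_⟩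
  · by_contra hcon
    push Not at hcon
    nlinarith
  · field_simp
    linear_combination i2
  · field_simp
  · field_simp

lemma aux_pq (E F G : ℝ) (hE : 0 < E) (hG : 0 < G) (hF : 0 < F) (hd : 4 * E * G < F ^ 2) :
    ∃ p q : ℝ, 0 < p ∧ 0 < q ∧ p < q ∧ F = G * (p + q) ∧ E = G * (p * q) := by
  have hd' : 0 < F ^ 2 - 4 * E * G := by linarith
  have h1 := Real.sqrt_pos.2 hd'
  have h2 := Real.sq_sqrt hd'.le
  have hEG : 0 < E * G := by positivity
  set d := Real.sqrt (F ^ 2 - 4 * E * G)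
  have h3 : d < F := by nlinarith
  refine ⟨(F - d) / (2 * G), (F + d) / (2 * G), ?_, ?_, ?_, ?_, ?_⟩
  · apply div_pos <;> linarith
  · apply div_pos <;> linarith
  · apply div_lt_div_of_pos_right <;> linarith
  · field_simp; ring
  · field_simp; linear_combination h2

lemma aux_pf (A B R G p q x w : ℝ) (hG : 0 < G) (hp : 0 < p) (hq : 0 < q) (hpq : p < q)
    (hx : 0 < x) (hN : 0 < B + R - A) (hw : 0 < w)
    (h : G * ((1 + p) * (1 + q)) = (B + R - A) ^ 2) :
    2 * x * ((A + R * x - B * x ^ 2) / (G * ((x ^ 2 + p) * (x ^ 2 + q)))) / ((1 + x) * w) =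
    2 / (B + R - A) * (1 / ((1 + x) * w)) -
      1 / (G * (q - p)) * (2 * ((R - A - B * p) / (1 + p) * p - (A + B * p + R * p) / (1 + p) * x)
        / (w * (x ^ 2 + p)) -
      2 * ((R - A - B * q) / (1 + q) * q - (A + B * q + R * q) / (1 + q) * x)
        / (w * (x ^ 2 + q))) := by
  have hG' : G = (B + R - A) ^ 2 / ((1 + p) * (1 + q)) := by
    rw [eq_div_iff (by positivity)]; exact h
  have h1 : q - p ≠ 0 := by linarith
  have h2 : x ^ 2 + p ≠ 0 := by positivity
  have h3 : x ^ 2 + q ≠ 0 := by positivity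
  rw [hG']
  field_simp
  ring

set_option maxHeartbeats 1000000 in
lemma aux_main (t s r : ℝ) (ht : 0 < t) (hts : t < s) (hs : s < 1)
    (hr : 12 < 2 * r * (1 - t) * (1 - s)) :
    ∃ Φ : ℝ → ℝ, ContinuousOn Φ (Set.Icc t s) ∧
      (∀ x ∈ Set.Ioo t s, HasDerivAt Φ (2 * x * ((t + s - 2 * s * t + (2 * r * (1 - t) * (1 - s)) * x
        + x ^ 2 * (t + s - 2)) /
        (((t + s - 2 * s * t) ^ 2 + 2 * (2 * r * (1 - t) * (1 - s)) * s * t) +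
      (2 * (t + s - 2) * (t + s - 2 * s * t) +
        2 * (2 * r * (1 - t) * (1 - s)) * (1 + s * t - 2 * t - 2 * s)
          + (2 * r * (1 - t) * (1 - s)) ^ 2) * x ^ 2
      + ((t + s - 2) ^ 2 + 2 * (2 * r * (1 - t) * (1 - s))) * (x ^ 2) ^ 2)) /
        ((1 + x) * Real.sqrt ((x - t) * (s - x)))) x) ∧
      (∀ x ∈ Set.Ioo t s, 0 ≤ ((t + s - 2 * s * t + (2 * r * (1 - t) * (1 - s)) * x
        + x ^ 2 * (t + s - 2)) /
        (((t + s - 2 * s * t) ^ 2 + 2 * (2 * r * (1 - t) * (1 - s)) * s * t) +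
      (2 * (t + s - 2) * (t + s - 2 * s * t) +
        2 * (2 * r * (1 - t) * (1 - s)) * (1 + s * t - 2 * t - 2 * s)
          + (2 * r * (1 - t) * (1 - s)) ^ 2) * x ^ 2
      + ((t + s - 2) ^ 2 + 2 * (2 * r * (1 - t) * (1 - s))) * (x ^ 2) ^ 2))) ∧
      (1 + r) * (Φ s - Φ t) =
        Real.pi / ((1 - t) * (1 - s) * Real.sqrt ((1 + t) * (1 + s))) := by
  set R := 2 * r * (1 - t) * (1 - s) with hRd
  have hst : 0 < (1 - t) * (1 - s) := mul_pos (by linarith) (by linarith)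
  have hR : 0 < R := by linarith
  have hr0 : 0 < r := by
    by_contra hcon
    push Not at hcon
    have : R = 2 * (r * ((1 - t) * (1 - s))) := by rw [hRd]; ring
    nlinarith
  have hA : 0 < t + s - 2 * s * t := by nlinarith
  have hA2 : t + s - 2 * s * t < 2 := by nlinarith
  have hB : 0 < 2 - t - s := by linarith
  have hs0 : 0 < s := by linarith
  have hst1 : 0 < s * t := by positivity
  have hst2 : s * t < 1 := by nlinarith
  set E := (t + s - 2 * s * t) ^ 2 + 2 * R * s * t with hE
  set F := 2 * (t + s - 2) * (t + s - 2 * s * t) +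
        2 * R * (1 + s * t - 2 * t - 2 * s) + R ^ 2 with hF
  set G := (t + s - 2) ^ 2 + 2 * R with hG
  have hE0 : 0 < E := by positivity
  have hG0 : 0 < G := by positivity
  have hE1 : E < 4 + 2 * R := by
    have : R * (s * t) < R * 1 := by gcongr
    nlinarith
  have hG1 : G < 4 + 2 * R := by nlinarith
  have hF1 : 8 + 4 * R < F := by
    have h1 : (2 - t - s) * (t + s - 2 * s * t) < 2 * 2 := by
      apply mul_lt_mul'' <;> linarith
    have h2 : -3 < 1 + s * t - 2 * t - 2 * s := by linarith
    have h3 : R * (-3) < R * (1 + s * t - 2 * t - 2 * s) := by gcongr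
    have h4 : 12 * R < R * R := by gcongr
    have h5 : F = -2 * ((2 - t - s) * (t + s - 2 * s * t)) +
      2 * (R * (1 + s * t - 2 * t - 2 * s)) + R * R := by rw [hF]; ring
    linarith
  have hd : 4 * E * G < F ^ 2 := by
    have h1 : E * G < (4 + 2 * R) * (4 + 2 * R) := by
      apply mul_lt_mul'' <;> linarith
    have h2 : (8 + 4 * R) ^ 2 < F ^ 2 := by
      apply pow_lt_pow_left₀ hF1 (by positivity) (by norm_num)
    have h3 : 4 * E * G = 4 * (E * G) := by ring
    have h4 : 4 * ((4 + 2 * R) * (4 + 2 * R)) = (8 + 4 * R) ^ 2 := by ring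
    linarith
  obtain ⟨p, q, hp, hq, hpq, e1, e2⟩ := aux_pq E F G hE0 hG0 (by linarith) hd
  have hk := Real.sq_sqrt (show 0 ≤ 2 * R by positivity)
  have hk0 := Real.sqrt_pos.2 (show 0 < 2 * R by positivity)
  set k := Real.sqrt (2 * R)
  obtain ⟨a, b, ha, hb, hab, hab2, ka, kb⟩ := aux_ab t s R k p hk hk0 hp ht hs0 hA hB hR
    (by rw [← hE, ← hF, ← hG, e1, e2]; ring)
  obtain ⟨a', b', ha', hb', hab', hab2', ka', kb'⟩ := aux_ab t s R k q hk hk0 hq ht hs0 hA hB hR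
    (by rw [← hE, ← hF, ← hG, e1, e2]; ring)
  have hN : 0 < (2 - t - s) + R - (t + s - 2 * s * t) := by linarith
  refine ⟨fun x => 2 / ((2 - t - s) + R - (t + s - 2 * s * t)) * auxJ t s x -
    k / (G * (q - p)) * (auxL t s a b x - auxL t s a' b' x), ?_, ?_, ?_, ?_⟩
  · have cJ : ContinuousOn (auxJ t s) (Set.Icc t s) := by
      unfold auxJ
      apply ContinuousOn.div_const
      apply Real.continuous_arcsin.comp_continuousOn
      apply ContinuousOn.div_const
      apply ContinuousOn.sub (by fun_prop)
      apply ContinuousOn.div (by fun_prop) (by fun_prop)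
      intro x hx
      have := hx.1
      linarith
    have cL : ∀ a b p : ℝ, 0 < a → 0 < b → 0 < p → 2 * a * b = s + t →
        b ^ 2 + s * t = (a ^ 2 + 1) * p → ContinuousOn (auxL t s a b) (Set.Icc t s) := by
      intro a b p ha hb hp h1 h2
      unfold auxL
      apply ContinuousOn.sub
      · apply ContinuousOn.log (by fun_prop)
        intro x hx
        exact (auxL_pos t s a b p x ha hb hp ht h1 h2 hx.1 hx.2).1.ne'
      · apply ContinuousOn.log (by fun_prop)
        intro x hx
        exact (auxL_pos t s a b p x ha hb hp ht h1 h2 hx.1 hx.2).2.ne'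
    exact (cJ.const_mul _).sub (((cL a b p ha hb hp hab hab2).sub
      (cL a' b' q ha' hb' hq hab' hab2')).const_mul _)
  · intro x hx
    have dJ := auxJ_deriv t s x ht hx.1 hx.2
    have dL := auxL_deriv t s a b p x ha hb hp ht hab hab2 hx.1 hx.2
    have dL' := auxL_deriv t s a' b' q x ha' hb' hq ht hab' hab2' hx.1 hx.2
    have := (dJ.const_mul (2 / ((2 - t - s) + R - (t + s - 2 * s * t)))).sub
      ((dL.sub dL').const_mul (k / (G * (q - p))))
    refine this.congr_deriv ?_
    have hw := Real.sqrt_pos.2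
      (show 0 < (x - t) * (s - x) from mul_pos (by linarith [hx.1]) (by linarith [hx.2]))
    have key := aux_pf (t + s - 2 * s * t) (2 - t - s) R G p q x
      (Real.sqrt ((x - t) * (s - x))) hG0 hp hq hpq (by linarith [hx.1]) hN hw (by
        have : G * ((1 + p) * (1 + q)) = E + F + G := by rw [e1, e2]; ring
        rw [this, hE, hF, hG]; ring)
    rw [← ka, ← kb, ← ka', ← kb'] at key
    have hDD : E + F * x ^ 2 + G * (x ^ 2) ^ 2 = G * ((x ^ 2 + p) * (x ^ 2 + q)) := by
      rw [e1, e2]; ring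
    have hNN : t + s - 2 * s * t + R * x + x ^ 2 * (t + s - 2) =
      (t + s - 2 * s * t) + R * x - (2 - t - s) * x ^ 2 := by ring
    rw [hDD, hNN, key]
    ring
  · intro x hx
    have hx0 : 0 < x := by linarith [hx.1]
    have hx1 : x < 1 := by linarith [hx.2]
    have hF0 : 0 < F := by linarith
    apply div_nonneg
    · nlinarith
    · positivity
  · have hL : ∀ a b, auxL t s a b s = 0 ∧ auxL t s a b t = 0 := by
      intro a b
      unfold auxL
      simp
    have hJs : auxJ t s s = (Real.pi / 2) / Real.sqrt ((1 + t) * (1 + s)) := by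
      unfold auxJ
      have : ((1 + t) + (1 + s) - 2 * ((1 + t) * (1 + s)) / (1 + s)) / (s - t) = 1 := by
        have : s - t ≠ 0 := by linarith
        field_simp; ring
      rw [this, Real.arcsin_one]
    have hJt : auxJ t s t = (-(Real.pi / 2)) / Real.sqrt ((1 + t) * (1 + s)) := by
      unfold auxJ
      have : ((1 + t) + (1 + s) - 2 * ((1 + t) * (1 + s)) / (1 + t)) / (s - t) = -1 := by
        have : s - t ≠ 0 := by linarith
        field_simp; ring
      rw [this, Real.arcsin_neg_one]
    simp only [(hL _ _).1, (hL _ _).2, hJs, hJt]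
    have : (2 - t - s) + R - (t + s - 2 * s * t) = 2 * ((1 - t) * (1 - s)) * (1 + r) := by
      rw [hRd]; ring
    rw [this]
    have hK : 0 < Real.sqrt ((1 + t) * (1 + s)) := Real.sqrt_pos.2 (by positivity)
    have g1 : 1 - t ≠ 0 := by linarith
    have g2 : 1 - s ≠ 0 := by linarith
    field_simp
    ring

theorem stmt_19 (T S : ℝ) (hT : 0 < T) (hTS : T < S) (hS : S < 1) :
    ∃ r₀ > (0 : ℝ), ∀ r > r₀,
      Qc S T r = Real.pi / (Real.sqrt (1 - T) * Real.sqrt (1 - S) *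
        Real.sqrt (1 - Real.sqrt T) * Real.sqrt (1 - Real.sqrt S)) := by
  have hS0 : 0 < S := by linarith
  have ht := Real.sqrt_pos.2 hT
  have hts := Real.sqrt_lt_sqrt hT.le hTS
  have hs : Real.sqrt S < 1 := by rw [Real.sqrt_lt' one_pos]; simpa using hS
  have eT := Real.sq_sqrt hT.le
  have eS := Real.sq_sqrt hS0.le
  unfold Qc I2c Ec Fc Gc Rc
  set t := Real.sqrt T with htd
  set s := Real.sqrt S with hsd
  have h1t : 0 < 1 - t := by linarith
  have h1s : 0 < 1 - s := by linarith
  refine ⟨6 / ((1 - t) * (1 - s)), by positivity, fun r hr => ?_⟩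
  have hr' : 12 < 2 * r * (1 - t) * (1 - s) := by
    rw [gt_iff_lt, div_lt_iff₀ (by positivity)] at hr
    linarith
  obtain ⟨Φ, hc, hd, hn, hv⟩ := aux_main t s r ht hts hs hr'
  have hmem : ∀ z ∈ Set.Ioo T S, Real.sqrt z ∈ Set.Ioo t s := fun z hz =>
    ⟨Real.sqrt_lt_sqrt hT.le hz.1, Real.sqrt_lt_sqrt (hT.trans hz.1).le hz.2⟩
  have hcc : ContinuousOn (fun z => Φ (Real.sqrt z)) (Set.Icc T S) :=
    hc.comp Real.continuous_sqrt.continuousOn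
      (fun z hz => ⟨Real.sqrt_le_sqrt hz.1, Real.sqrt_le_sqrt hz.2⟩)
  have hder : ∀ z ∈ Set.Ioo T S, HasDerivAt (fun z => Φ (Real.sqrt z))
      ((t + s - 2 * s * t + 2 * r * (1 - t) * (1 - s) * Real.sqrt z + z * (t + s - 2)) /
        ((t + s - 2 * s * t) ^ 2 + 2 * (2 * r * (1 - t) * (1 - s)) * s * t +
          (2 * (t + s - 2) * (t + s - 2 * s * t) +
            2 * (2 * r * (1 - t) * (1 - s)) * (1 + s * t - 2 * t - 2 * s) +
            (2 * r * (1 - t) * (1 - s)) ^ 2) * z +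
          ((t + s - 2) ^ 2 + 2 * (2 * r * (1 - t) * (1 - s))) * z ^ 2) /
        ((1 + Real.sqrt z) * Real.sqrt (Real.sqrt z - t) * Real.sqrt (s - Real.sqrt z))) z := by
    intro z hz
    have hz0 : 0 < z := hT.trans hz.1
    have hm := hmem z hz
    have := (hd _ hm).comp z (Real.hasDerivAt_sqrt hz0.ne')
    refine this.congr_deriv ?_
    have hx := Real.sqrt_pos.2 hz0
    rw [Real.sq_sqrt hz0.le, Real.sqrt_mul (by linarith [hm.1])]
    field_simp
  have hnn : ∀ z ∈ Set.Ioo T S, 0 ≤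
      ((t + s - 2 * s * t + 2 * r * (1 - t) * (1 - s) * Real.sqrt z + z * (t + s - 2)) /
        ((t + s - 2 * s * t) ^ 2 + 2 * (2 * r * (1 - t) * (1 - s)) * s * t +
          (2 * (t + s - 2) * (t + s - 2 * s * t) +
            2 * (2 * r * (1 - t) * (1 - s)) * (1 + s * t - 2 * t - 2 * s) +
            (2 * r * (1 - t) * (1 - s)) ^ 2) * z +
          ((t + s - 2) ^ 2 + 2 * (2 * r * (1 - t) * (1 - s))) * z ^ 2) /
        ((1 + Real.sqrt z) * Real.sqrt (Real.sqrt z - t) * Real.sqrt (s - Real.sqrt z))) := by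
    intro z hz
    have := hn _ (hmem z hz)
    rw [Real.sq_sqrt (hT.trans hz.1).le] at this
    exact div_nonneg this (by positivity)
  have hint := intervalIntegral.integrableOn_deriv_of_nonneg hcc hder hnn
  rw [intervalIntegral.integral_eq_sub_of_hasDerivAt_of_le hTS.le hcc hder
    ((intervalIntegrable_iff_integrableOn_Ioc_of_le hTS.le).2 hint)]
  rw [← htd, ← hsd, hv]
  congr 1
  have f1 : 1 - T = (1 - t) * (1 + t) := by rw [← eT]; ring
  have f2 : 1 - S = (1 - s) * (1 + s) := by rw [← eS]; ring
  rw [f1, f2, Real.sqrt_mul h1t.le, Real.sqrt_mul h1s.le, Real.sqrt_mul (by linarith)]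
  have g1 := Real.sq_sqrt h1t.le
  have g2 := Real.sq_sqrt h1s.le
  linear_combination (-(1 - s) * Real.sqrt (1 + t) * Real.sqrt (1 + s)) * g1 -
    (Real.sqrt (1 - t) ^ 2 * Real.sqrt (1 + t) * Real.sqrt (1 + s)) * g2
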